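/- arXiv:1701.01927 — 10 statements merged into one kernel-verified Lean document; each statement's English description precedes it below -/
import Mathlib

section
/- Let ℓ be an odd prime and let M be an invertible 2×2 matrix over 𝔽_ℓ with trace t and determinant q. Let e be the least positive integer such that M^e is a scalar matrix. If gcd(e, ℓ) = 1, then there exists an element ζ of multiplicative order e in the field 𝔽_{ℓ²} with ℓ² elements such that t² = (ζ + ζ⁻¹ + 2)·q in 𝔽_{ℓ²} (identifying t and q with their images under the canonical embedding 𝔽_ℓ → 𝔽_{ℓ²}); if ℓ divides e, then t² = 4q in 𝔽_ℓ. -/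
open Matrix

theorem aux_sq {F : Type*} [Field F] (M : Matrix (Fin 2) (Fin 2) F) :
    M * M = M.trace • M - M.det • (1 : Matrix (Fin 2) (Fin 2) F) := by
  ext i j
  fin_cases i <;> fin_cases j <;>
    simp [Matrix.mul_apply, Fin.sum_univ_two, Matrix.trace_fin_two, Matrix.det_fin_two] <;> ring

theorem aux_pow {F K : Type*} [Field F] [Field K] [Algebra F K]
    (M : Matrix (Fin 2) (Fin 2) F) (k : ℕ) :
    ∃ a b : F, M ^ k = a • M + b • (1 : Matrix (Fin 2) (Fin 2) F) ∧
      ∀ x : K, x * x = algebraMap F K M.trace * x - algebraMap F K M.det →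
        x ^ k = algebraMap F K a * x + algebraMap F K b := by
  induction k with
  | zero => exact ⟨0, 1, by simp, by simp⟩
  | succ k ih =>
    obtain ⟨a, b, h1, h2⟩ := ih
    refine ⟨a * M.trace + b, - a * M.det, ?_, ?_⟩
    · rw [pow_succ, h1, add_mul, smul_mul_assoc, aux_sq M, smul_mul_assoc, one_mul]
      module
    · intro x hx
      rw [pow_succ, h2 x hx]
      simp only [map_add, map_mul, map_neg]
      linear_combination algebraMap F K a * hx

theorem aux_rep {F : Type*} [Field F]
    (M : Matrix (Fin 2) (Fin 2) F) (c : F) (h1 : M.trace = 2 * c) (h2 : M.det = c ^ 2) (k : ℕ) :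
    M ^ (k + 1) = ((k + 1 : ℕ) * c ^ k : F) • M
      - ((k : F) * c ^ (k + 1)) • (1 : Matrix (Fin 2) (Fin 2) F) := by
  induction k with
  | zero => simp
  | succ k ih =>
    rw [pow_succ, ih, sub_mul, smul_mul_assoc, aux_sq M, smul_mul_assoc, one_mul, h1, h2]
    push_cast
    module

theorem aux_scalar {F : Type*} [Field F] (M : Matrix (Fin 2) (Fin 2) F) (a b c : F)
    (h : a • M + b • (1 : Matrix (Fin 2) (Fin 2) F) = c • (1 : Matrix (Fin 2) (Fin 2) F))
    (ha : a ≠ 0) : ∃ d : F, M = d • (1 : Matrix (Fin 2) (Fin 2) F) := by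
  refine ⟨a⁻¹ * (c - b), ?_⟩
  rw [mul_smul, sub_smul, ← h, add_sub_cancel_right, smul_smul, inv_mul_cancel₀ ha, one_smul]

theorem aux_isSquare (ℓ : ℕ) [Fact (Nat.Prime ℓ)] (hodd : Odd ℓ) (d : ZMod ℓ) :
    IsSquare (algebraMap (ZMod ℓ) (GaloisField ℓ 2) d) := by
  by_cases hd : d = 0
  · simp [hd]
  have : Fintype (GaloisField ℓ 2) := Fintype.ofFinite _
  have hc : Fintype.card (GaloisField ℓ 2) = ℓ ^ 2 := by
    rw [← Nat.card_eq_fintype_card, GaloisField.card ℓ 2 (by norm_num)]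
  have hchar : ringChar (GaloisField ℓ 2) ≠ 2 := by
    rw [ringChar.eq (GaloisField ℓ 2) ℓ]
    rintro rfl
    exact absurd hodd (by decide)
  rw [FiniteField.isSquare_iff hchar (by simpa using hd), hc]
  obtain ⟨m, hm⟩ := hodd
  have h3 : ℓ ^ 2 / 2 = (ℓ - 1) * (m + 1) := by
    subst hm
    have : (2 * m + 1) ^ 2 = 2 * (2 * m * (m + 1)) + 1 := by ring
    rw [this, Nat.add_sub_cancel]
    omega
  rw [h3, pow_mul, ← map_pow, ZMod.pow_card_sub_one_eq_one hd, map_one, one_pow]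

/-- Let ℓ be an odd prime and M an invertible 2×2 matrix over 𝔽_ℓ with trace t and
determinant q. Let e be the least positive integer such that M^e is scalar.
If gcd(e, ℓ) = 1, there exists ζ of multiplicative order e in 𝔽_{ℓ²} with
t² = (ζ + ζ⁻¹ + 2)·q in 𝔽_{ℓ²}; if ℓ ∣ e then t² = 4q in 𝔽_ℓ. -/
theorem stmt0 (ℓ : ℕ) [Fact (Nat.Prime ℓ)] (hodd : Odd ℓ)
    (M : Matrix (Fin 2) (Fin 2) (ZMod ℓ)) (hM : IsUnit M)
    (t q : ZMod ℓ) (ht : M.trace = t) (hq : M.det = q)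
    (e : ℕ)
    (he : IsLeast {k : ℕ | 0 < k ∧
      ∃ c : ZMod ℓ, M ^ k = c • (1 : Matrix (Fin 2) (Fin 2) (ZMod ℓ))} e) :
    (Nat.gcd e ℓ = 1 →
      ∃ ζ : GaloisField ℓ 2, orderOf ζ = e ∧
        (algebraMap (ZMod ℓ) (GaloisField ℓ 2) t) ^ 2
          = (ζ + ζ⁻¹ + 2) * algebraMap (ZMod ℓ) (GaloisField ℓ 2) q) ∧
    (ℓ ∣ e → t ^ 2 = 4 * q) := by
  subst ht hq
  have hp : Nat.Prime ℓ := Fact.out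
  obtain ⟨⟨he0, c, hc⟩, hmin⟩ := he
  have h2 : (2 : ZMod ℓ) ≠ 0 := by
    intro h
    have h' : ((2 : ℕ) : ZMod ℓ) = 0 := by exact_mod_cast h
    rw [ZMod.natCast_eq_zero_iff] at h'
    have := (Nat.prime_dvd_prime_iff_eq hp Nat.prime_two).1 h'
    subst this
    exact absurd hodd (by decide)
  have hdet : M.det ≠ 0 := ((Matrix.isUnit_iff_isUnit_det M).1 hM).ne_zero
  by_cases hs : ∃ d : ZMod ℓ, M = d • (1 : Matrix (Fin 2) (Fin 2) (ZMod ℓ))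
  · have he1 : e = 1 := le_antisymm (hmin ⟨one_pos, by simpa using hs⟩) he0
    obtain ⟨d, hd⟩ := hs
    have htq : M.trace ^ 2 = 4 * M.det := by
      rw [hd]; simp [Matrix.trace_fin_two, Matrix.det_fin_two]; ring
    refine ⟨fun _ => ⟨1, by simp [he1], ?_⟩, fun _ => htq⟩
    rw [← map_pow, htq, map_mul, map_ofNat]
    norm_num
  by_cases htq : M.trace ^ 2 = 4 * M.det
  · refine ⟨fun hg => absurd ?_ hs, fun _ => htq⟩
    have hA : M.trace = 2 * (M.trace / 2) := by field_simp
    have hB : M.det = (M.trace / 2) ^ 2 := by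
      have h4 : (2 : ZMod ℓ) * 2 ≠ 0 := mul_ne_zero h2 h2
      field_simp
      linear_combination -htq
    have hc0 : M.trace / 2 ≠ 0 := by
      intro h
      rw [h] at hB
      exact hdet (by simpa using hB)
    obtain ⟨k, rfl⟩ : ∃ k, e = k + 1 := ⟨e - 1, by omega⟩
    rw [aux_rep M _ hA hB k, sub_eq_add_neg, ← neg_smul] at hc
    refine aux_scalar M _ _ _ hc (mul_ne_zero ?_ (pow_ne_zero _ hc0))
    intro h
    rw [ZMod.natCast_eq_zero_iff] at h
    have := Nat.dvd_gcd h dvd_rfl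
    rw [hg] at this
    exact hp.one_lt.ne' (Nat.dvd_one.1 this)
  · obtain ⟨r, hr⟩ := aux_isSquare ℓ hodd (M.trace ^ 2 - 4 * M.det)
    have h2K : (2 : GaloisField ℓ 2) ≠ 0 := by
      have := (map_ne_zero (algebraMap (ZMod ℓ) (GaloisField ℓ 2))).2 h2
      rwa [map_ofNat] at this
    have hr0 : r ≠ 0 := by
      rintro rfl
      rw [mul_zero, map_eq_zero] at hr
      exact htq (sub_eq_zero.1 hr)
    have hdK := (map_ne_zero (algebraMap (ZMod ℓ) (GaloisField ℓ 2))).2 hdet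
    have hpw := aux_pow (K := GaloisField ℓ 2) M
    simp only [map_sub, map_mul, map_pow, map_ofNat] at hr
    generalize hT : algebraMap (ZMod ℓ) (GaloisField ℓ 2) M.trace = T at *
    generalize hQ : algebraMap (ZMod ℓ) (GaloisField ℓ 2) M.det = Q at *
    obtain ⟨x, hx⟩ : ∃ x : GaloisField ℓ 2, 2 * x = T + r := ⟨(T + r) / 2, by field_simp⟩
    obtain ⟨y, hy⟩ : ∃ y : GaloisField ℓ 2, 2 * y = T - r := ⟨(T - r) / 2, by field_simp⟩
    have hsum : x + y = T := mul_left_cancel₀ h2K (by linear_combination hx + hy)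
    have hdif : x - y = r := mul_left_cancel₀ h2K (by linear_combination hx - hy)
    have hprod : x * y = Q := by
      refine mul_left_cancel₀ (mul_ne_zero h2K h2K) ?_
      linear_combination 2 * y * hx + (T + r) * hy + hr
    have hxy : x - y ≠ 0 := hdif ▸ hr0
    have hx0 : x ≠ 0 := by rintro rfl; exact hdK (by rw [← hprod, zero_mul])
    have hy0 : y ≠ 0 := by rintro rfl; exact hdK (by rw [← hprod, mul_zero])
    have key : ∀ k : ℕ, (∃ c : ZMod ℓ, M ^ k = c • (1 : Matrix (Fin 2) (Fin 2) (ZMod ℓ))) ↔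
        (x / y) ^ k = 1 := by
      intro k
      obtain ⟨a, b, hab, hK⟩ := hpw k
      have e1 := hK x (by rw [← hsum, ← hprod]; ring)
      have e2 := hK y (by rw [← hsum, ← hprod]; ring)
      have hiff : (x / y) ^ k = 1 ↔ a = 0 := by
        rw [div_pow, div_eq_one_iff_eq (pow_ne_zero _ hy0), e1, e2]
        constructor
        · intro h
          have : algebraMap (ZMod ℓ) (GaloisField ℓ 2) a * (x - y) = 0 := by
            linear_combination h
          exact (map_eq_zero _).1 ((mul_eq_zero.1 this).resolve_right hxy)
        · rintro rfl; simp
      rw [hiff, hab]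
      constructor
      · rintro ⟨c, hc⟩
        by_contra ha
        exact hs (aux_scalar M _ _ _ hc ha)
      · rintro rfl
        exact ⟨b, by simp⟩
    have hord : orderOf (x / y) = e := by
      have h1 := (key e).1 ⟨c, hc⟩
      refine le_antisymm (orderOf_le_of_pow_eq_one he0 h1) (hmin ⟨?_, ?_⟩)
      · exact orderOf_pos_iff.2 (isOfFinOrder_iff_pow_eq_one.2 ⟨e, he0, h1⟩)
      · exact (key _).2 (pow_orderOf_eq_one _)
    refine ⟨fun _ => ⟨x / y, hord, ?_⟩, fun hdvd => ?_⟩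
    · rw [← hsum, ← hprod]
      field_simp
      ring
    · exfalso
      have : Fintype (GaloisField ℓ 2) := Fintype.ofFinite _
      have hcard : Fintype.card (GaloisField ℓ 2) = ℓ ^ 2 := by
        rw [← Nat.card_eq_fintype_card, GaloisField.card ℓ 2 (by norm_num)]
      have h1 := FiniteField.pow_card_sub_one_eq_one (x / y) (div_ne_zero hx0 hy0)
      rw [hcard] at h1
      have h3 : ℓ ∣ ℓ ^ 2 - 1 := hdvd.trans (hord ▸ orderOf_dvd_of_pow_eq_one h1)
      have h4 : ℓ ∣ 1 := (Nat.dvd_sub_iff_right (Nat.one_le_pow _ _ hp.pos) (dvd_pow_self ℓ two_ne_zero)).1 h3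
      exact hp.one_lt.ne' (Nat.dvd_one.1 h4)
end

section
/- Let ℓ be an odd prime and let M be an invertible 2×2 matrix over 𝔽_ℓ with trace t and determinant q. Suppose M is not a scalar matrix and t² = 4q in 𝔽_ℓ (i.e., the characteristic polynomial of M has a repeated root). Then the least positive integer e such that M^e is a scalar matrix equals ℓ. -/
open Matrix

/-- If M is an invertible 2×2 matrix over 𝔽_ℓ (ℓ an odd prime) that is not scalar and
whose trace t and determinant q satisfy t² = 4q, then the least positive integer e
with M^e scalar equals ℓ. -/
theorem stmt1 (ℓ : ℕ) [Fact (Nat.Prime ℓ)] (hodd : Odd ℓ)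
    (M : Matrix (Fin 2) (Fin 2) (ZMod ℓ)) (hM : IsUnit M)
    (t q : ZMod ℓ) (ht : M.trace = t) (hq : M.det = q)
    (hns : ¬ ∃ c : ZMod ℓ, M = c • (1 : Matrix (Fin 2) (Fin 2) (ZMod ℓ)))
    (hrep : t ^ 2 = 4 * q) :
    IsLeast {k : ℕ | 0 < k ∧
      ∃ c : ZMod ℓ, M ^ k = c • (1 : Matrix (Fin 2) (Fin 2) (ZMod ℓ))} ℓ := by
  have hp : Nat.Prime ℓ := Fact.out
  have h2 : (2 : ZMod ℓ) ≠ 0 := by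
    intro h
    have h' : ((2 : ℕ) : ZMod ℓ) = 0 := by exact_mod_cast h
    rw [ZMod.natCast_eq_zero_iff] at h'
    have := (Nat.prime_dvd_prime_iff_eq hp Nat.prime_two).1 h'
    subst this
    exact absurd hodd (by decide)
  obtain ⟨a, ha⟩ : ∃ a : ZMod ℓ, t = 2 * a := ⟨t / 2, by field_simp⟩
  have hqa : q = a ^ 2 := by
    have h4 : (2 * 2 : ZMod ℓ) ≠ 0 := mul_ne_zero h2 h2
    apply mul_left_cancel₀ h4
    rw [ha] at hrep
    linear_combination -hrep
  have ha0 : a ≠ 0 := by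
    rintro rfl
    have := (Matrix.isUnit_iff_isUnit_det M).1 hM
    rw [hq, hqa] at this
    simp at this
  obtain ⟨N, hN⟩ : ∃ N, N = M - a • (1 : Matrix (Fin 2) (Fin 2) (ZMod ℓ)) := ⟨_, rfl⟩
  have hMN : M = a • 1 + N := by rw [hN]; abel
  have hN2 : N * N = 0 := by
    rw [Matrix.trace_fin_two] at ht
    rw [Matrix.det_fin_two] at hq
    rw [ha] at ht
    rw [hqa] at hq
    rw [hN]
    ext i j
    fin_cases i <;> fin_cases j <;> simp [Matrix.mul_apply, Fin.sum_univ_two]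
    · linear_combination M 0 0 * ht - hq
    · linear_combination M 0 1 * ht
    · linear_combination M 1 0 * ht
    · linear_combination M 1 1 * ht - hq
  have key : ∀ k : ℕ, M ^ (k + 1) = a ^ (k + 1) • (1 : Matrix (Fin 2) (Fin 2) (ZMod ℓ))
      + (((k + 1 : ℕ) : ZMod ℓ) * a ^ k) • N := by
    intro k
    induction k with
    | zero => simp [← hMN]
    | succ k ih =>
      rw [pow_succ, ih]
      nth_rewrite 1 [hMN]
      simp only [mul_add, add_mul, smul_mul_assoc, mul_smul_comm, one_mul, mul_one, hN2, smul_zero]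
      push_cast
      module
  refine ⟨⟨hp.pos, a ^ ℓ, ?_⟩, ?_⟩
  · obtain ⟨k, hk⟩ : ∃ k, ℓ = k + 1 := ⟨ℓ - 1, by have := hp.pos; omega⟩
    have h := key k
    rw [← hk] at h
    rw [h]
    simp
  · rintro k ⟨hk, c, hc⟩
    obtain ⟨m, rfl⟩ : ∃ m, k = m + 1 := ⟨k - 1, by omega⟩
    rw [key] at hc
    apply Nat.le_of_dvd hk
    rw [← ZMod.natCast_eq_zero_iff]
    by_contra hne
    apply hns
    set b := ((m + 1 : ℕ) : ZMod ℓ) * a ^ m with hb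
    have hb0 : b ≠ 0 := mul_ne_zero hne (pow_ne_zero _ ha0)
    have h1 : b • N = (c - a ^ (m + 1)) • (1 : Matrix (Fin 2) (Fin 2) (ZMod ℓ)) := by
      rw [sub_smul, ← hc]; abel
    refine ⟨a + b⁻¹ * (c - a ^ (m + 1)), ?_⟩
    rw [add_smul, mul_smul, ← h1, smul_smul, inv_mul_cancel₀ hb0, one_smul]
    exact hMN
end

section
/- Let ℓ be an odd prime and let M be an invertible 2×2 matrix over 𝔽_ℓ whose characteristic polynomial is irreducible over 𝔽_ℓ, with root λ in the field 𝔽_{ℓ²} with ℓ² elements (so that the two roots are λ and λ^ℓ). Then the least positive integer e such that M^e is a scalar matrix satisfies e > 1, e equals the multiplicative order of λ^{ℓ−1} in 𝔽_{ℓ²}^×, and e divides ℓ + 1. -/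
open Matrix Polynomial

/-- If the characteristic polynomial of an invertible 2×2 matrix M over 𝔽_ℓ is
irreducible with root λ in 𝔽_{ℓ²}, then the least positive integer e with M^e scalar
satisfies e > 1, e equals the multiplicative order of λ^{ℓ−1} in 𝔽_{ℓ²}ˣ, and
e divides ℓ + 1. -/
theorem stmt3 (ℓ : ℕ) [Fact (Nat.Prime ℓ)] (hodd : Odd ℓ)
    (M : Matrix (Fin 2) (Fin 2) (ZMod ℓ)) (hM : IsUnit M)
    (hirr : Irreducible M.charpoly)
    (lam : GaloisField ℓ 2) (hroot : Polynomial.aeval lam M.charpoly = 0)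
    (e : ℕ)
    (he : IsLeast {k : ℕ | 0 < k ∧
      ∃ c : ZMod ℓ, M ^ k = c • (1 : Matrix (Fin 2) (Fin 2) (ZMod ℓ))} e) :
    1 < e ∧ e = orderOf (lam ^ (ℓ - 1)) ∧ e ∣ ℓ + 1 := by
  have hp : ℓ.Prime := Fact.out
  have h1M : M.charpoly = minpoly (ZMod ℓ) M :=
    minpoly.eq_of_irreducible_of_monic hirr (Matrix.aeval_self_charpoly M) M.charpoly_monic
  have h1l : M.charpoly = minpoly (ZMod ℓ) lam :=
    minpoly.eq_of_irreducible_of_monic hirr hroot M.charpoly_monic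
  have hdeg : M.charpoly.natDegree = 2 := by
    simpa using M.charpoly_natDegree_eq_dim
  have hnot : ∀ c : ZMod ℓ, lam ≠ algebraMap _ _ c := by
    intro c hc
    rw [h1l, hc, minpoly.eq_X_sub_C, natDegree_X_sub_C] at hdeg
    omega
  have h0 : lam ≠ 0 := by simpa using hnot 0
  have key : ∀ (k : ℕ) (c : ZMod ℓ),
      M ^ k = c • (1 : Matrix (Fin 2) (Fin 2) (ZMod ℓ)) ↔ lam ^ k = algebraMap _ _ c := by
    intro k c
    have a : M ^ k = c • (1 : Matrix (Fin 2) (Fin 2) (ZMod ℓ)) ↔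
        aeval M (X ^ k - C c : (ZMod ℓ)[X]) = 0 := by
      simp [sub_eq_zero, Algebra.algebraMap_eq_smul_one]
    have b : lam ^ k = algebraMap _ _ c ↔ aeval lam (X ^ k - C c : (ZMod ℓ)[X]) = 0 := by
      simp [sub_eq_zero]
    rw [a, b, ← minpoly.dvd_iff, ← minpoly.dvd_iff, ← h1M, ← h1l]
  have key2 : ∀ k : ℕ, (∃ c : ZMod ℓ, lam ^ k = algebraMap _ _ c) ↔
      (lam ^ (ℓ - 1)) ^ k = 1 := by
    intro k
    have e1 : (lam ^ (ℓ - 1)) ^ k = 1 ↔ (lam ^ k) ^ ℓ = lam ^ k := by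
      have : (lam ^ k) ^ ℓ = (lam ^ (ℓ - 1)) ^ k * lam ^ k := by
        rw [← pow_mul, ← pow_mul, ← pow_add]
        congr 1
        obtain ⟨m, rfl⟩ : ∃ m, ℓ = m + 1 := ⟨ℓ - 1, by have := hp.pos; omega⟩
        simp; ring
      rw [this, mul_eq_right₀ (pow_ne_zero _ h0)]
    rw [e1]
    constructor
    · rintro ⟨c, hc⟩
      rw [hc, ← map_pow, ZMod.pow_card]
    · intro h
      rw [← Subfield.mem_bot_iff_pow_eq_self (GaloisField ℓ 2) ℓ, mem_bot_iff_intCast ℓ] at h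
      obtain ⟨n, hn⟩ := h
      exact ⟨n, by simp [hn]⟩
  have hset : ∀ k : ℕ, (∃ c : ZMod ℓ, M ^ k = c • (1 : Matrix (Fin 2) (Fin 2) (ZMod ℓ))) ↔
      (lam ^ (ℓ - 1)) ^ k = 1 := by
    intro k
    simp only [key, key2]
  obtain ⟨⟨hpos, hex⟩, hmin⟩ := he
  have hpe := (hset e).1 hex
  have heq : e = orderOf (lam ^ (ℓ - 1)) := by
    apply le_antisymm
    · exact hmin ⟨orderOf_pos_iff.2 (isOfFinOrder_iff_pow_eq_one.2 ⟨e, hpos, hpe⟩),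
        (hset _).2 (pow_orderOf_eq_one _)⟩
    · exact orderOf_le_of_pow_eq_one hpos hpe
  refine ⟨?_, heq, ?_⟩
  · by_contra h
    have : e = 1 := by omega
    subst this
    obtain ⟨c, hc⟩ := (key2 1).2 hpe
    exact hnot c (by simpa using hc)
  · rw [heq]
    apply orderOf_dvd_of_pow_eq_one
    have : Fintype (GaloisField ℓ 2) := Fintype.ofFinite _
    have h := FiniteField.pow_card_sub_one_eq_one lam h0
    rw [← Nat.card_eq_fintype_card, GaloisField.card ℓ 2 two_ne_zero] at h
    rw [← pow_mul, mul_comm, ← h]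
    congr 1
    simpa using (Nat.sq_sub_sq ℓ 1).symm
end

section
/- Let ℓ be an odd prime and let t, s, q be elements of 𝔽_ℓ. The polynomial T⁴ − tT³ + (2q + s)T² − tqT + q² in 𝔽_ℓ[T] can be written as a product (T² − uT + q)(T² − u′T + q) for some u, u′ ∈ 𝔽_ℓ if and only if t² − 4s is a square in 𝔽_ℓ. -/
open Polynomial

/-- For an odd prime ℓ and t, s, q ∈ 𝔽_ℓ, the quartic
T⁴ − tT³ + (2q + s)T² − tqT + q² factors as (T² − uT + q)(T² − u′T + q)
for some u, u′ ∈ 𝔽_ℓ if and only if t² − 4s is a square in 𝔽_ℓ. -/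
theorem stmt4 (ℓ : ℕ) [Fact (Nat.Prime ℓ)] (hodd : Odd ℓ)
    (t s q : ZMod ℓ) :
    (∃ u u' : ZMod ℓ,
        (X ^ 4 - C t * X ^ 3 + C (2 * q + s) * X ^ 2 - C (t * q) * X + C (q ^ 2)
          : Polynomial (ZMod ℓ))
        = (X ^ 2 - C u * X + C q) * (X ^ 2 - C u' * X + C q))
    ↔ IsSquare (t ^ 2 - 4 * s) := by
  have h2 : (2 : ZMod ℓ) ≠ 0 := by
    intro h
    have h' : ((2 : ℕ) : ZMod ℓ) = 0 := by exact_mod_cast h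
    rw [ZMod.natCast_eq_zero_iff] at h'
    have h1 := (Nat.prime_dvd_prime_iff_eq (Fact.out : Nat.Prime ℓ) Nat.prime_two).1 h'
    subst h1
    exact absurd hodd (by decide)
  have key : ∀ u u' : ZMod ℓ, (X ^ 2 - C u * X + C q) * (X ^ 2 - C u' * X + C q)
      = X ^ 4 - C (u + u') * X ^ 3 + C (2 * q + u * u') * X ^ 2 - C ((u + u') * q) * X
        + C (q ^ 2) := by
    intro u u'
    have hc : (C (2 : ZMod ℓ) : Polynomial (ZMod ℓ)) = 2 := rfl
    simp only [map_add, map_mul, map_pow, hc]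
    ring
  constructor
  · rintro ⟨u, u', h⟩
    rw [key] at h
    have e3 := congrArg (fun p => coeff p 3) h
    have e2 := congrArg (fun p => coeff p 2) h
    simp only [coeff_add, coeff_sub, coeff_C_mul, coeff_X_pow, coeff_X, coeff_C] at e3 e2
    norm_num at e3 e2
    refine ⟨u - u', ?_⟩
    have e3' : t = u + u' := by linear_combination -e3
    rw [e3', e2]
    ring
  · rintro ⟨r, hr⟩
    refine ⟨(t + r) / 2, (t - r) / 2, ?_⟩
    have a : (t + r) / 2 + (t - r) / 2 = t := by field_simp; ring
    have b : (t + r) / 2 * ((t - r) / 2) = s := by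
      field_simp
      linear_combination hr
    rw [key, a, b]
end

section
/- Let ℓ be an odd prime and let M be an invertible 2×2 matrix over 𝔽_ℓ with determinant q, whose characteristic polynomial is irreducible over 𝔽_ℓ. Let e be the least positive integer such that M^e is a scalar matrix (so e divides ℓ + 1). Then (ℓ + 1)/e is even if and only if q is a square in 𝔽_ℓ. -/
open Matrix

open Polynomial in
/-- Let M be an invertible 2×2 matrix over 𝔽_ℓ with determinant q and irreducible
characteristic polynomial, and let e be the least positive integer with M^e scalar.
Then e divides ℓ + 1, and (ℓ + 1)/e is even if and only if q is a square in 𝔽_ℓ. -/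
theorem stmt6 (ℓ : ℕ) [Fact (Nat.Prime ℓ)] (hodd : Odd ℓ)
    (M : Matrix (Fin 2) (Fin 2) (ZMod ℓ)) (hM : IsUnit M)
    (q : ZMod ℓ) (hq : M.det = q)
    (hirr : Irreducible M.charpoly)
    (e : ℕ)
    (he : IsLeast {k : ℕ | 0 < k ∧
      ∃ c : ZMod ℓ, M ^ k = c • (1 : Matrix (Fin 2) (Fin 2) (ZMod ℓ))} e) :
    e ∣ ℓ + 1 ∧ (Even ((ℓ + 1) / e) ↔ IsSquare q) := by
  haveI : Fact (Irreducible M.charpoly) := ⟨hirr⟩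
  let K := AdjoinRoot M.charpoly
  let f : ZMod ℓ →+* K := AdjoinRoot.of M.charpoly
  let α : K := AdjoinRoot.root M.charpoly
  have hinj : Function.Injective f := f.injective
  have hmin : M.charpoly = minpoly (ZMod ℓ) M :=
    minpoly.eq_of_irreducible_of_monic hirr (Matrix.aeval_self_charpoly M) (Matrix.charpoly_monic M)
  have key : ∀ (k : ℕ) (c : ZMod ℓ),
      M ^ k = c • (1 : Matrix (Fin 2) (Fin 2) (ZMod ℓ)) ↔ α ^ k = f c := by
    intro k c
    have h1 : α ^ k = f c ↔ M.charpoly ∣ X ^ k - C c := by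
      rw [← AdjoinRoot.mk_eq_zero, map_sub, sub_eq_zero, map_pow, AdjoinRoot.mk_X, AdjoinRoot.mk_C]
    rw [h1, hmin, minpoly.dvd_iff, map_sub, sub_eq_zero, map_pow, aeval_X, aeval_C,
      Algebra.algebraMap_eq_smul_one]
  have hdeg : M.charpoly.natDegree = 2 := by
    simpa using Matrix.charpoly_natDegree_eq_dim M
  have hαF : ∀ a, α ≠ f a := by
    intro a h
    have : M.charpoly ∣ X - C a := by
      rw [← AdjoinRoot.mk_eq_zero, map_sub, sub_eq_zero, AdjoinRoot.mk_X, AdjoinRoot.mk_C]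
      exact h
    have := natDegree_le_of_dvd this (X_sub_C_ne_zero a)
    rw [hdeg, natDegree_X_sub_C] at this
    omega
  have hroot : α ^ 2 - f M.trace * α + f q = 0 := by
    have : AdjoinRoot.mk M.charpoly M.charpoly = 0 := AdjoinRoot.mk_self
    conv at this => lhs; arg 2; rw [Matrix.charpoly_fin_two]
    rw [map_add, map_sub, map_mul, map_pow, AdjoinRoot.mk_X, AdjoinRoot.mk_C, AdjoinRoot.mk_C, hq] at this
    exact this
  have hq0 : q ≠ 0 := by
    rw [← hq]; exact ((Matrix.isUnit_iff_isUnit_det M).1 hM).ne_zero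
  have hα0 : α ≠ 0 := by
    have := hαF 0
    rwa [map_zero] at this
  haveI : CharP K ℓ := charP_of_injective_ringHom hinj ℓ
  have hfix : α ^ ℓ ≠ α := by
    intro h
    have h2 : α ∈ (⊥ : Subfield K) := (Subfield.mem_bot_iff_pow_eq_self K ℓ).2 h
    have h3 : α ∈ f.fieldRange := (bot_le : (⊥ : Subfield K) ≤ f.fieldRange) h2
    obtain ⟨a, ha⟩ := h3
    exact hαF a ha.symm
  have hfrob : (α ^ ℓ) ^ 2 - f M.trace * α ^ ℓ + f q = 0 := by
    have := congrArg (frobenius K ℓ) hroot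
    rw [map_add, map_sub, map_mul, map_pow, map_zero] at this
    simp only [frobenius_def] at this
    rwa [← map_pow, ← map_pow, ZMod.pow_card, ZMod.pow_card] at this
  have hsum : α ^ ℓ = f M.trace - α := by
    have : (α ^ ℓ - α) * (α ^ ℓ - (f M.trace - α)) = 0 := by
      linear_combination hfrob - hroot
    rcases mul_eq_zero.1 this with h | h
    · exact absurd (sub_eq_zero.1 h) hfix
    · exact sub_eq_zero.1 h
  have hnorm : α ^ (ℓ + 1) = f q := by
    rw [pow_succ, hsum]; linear_combination -hroot
  obtain ⟨⟨hepos, c, hc⟩, hmin'⟩ := he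
  rw [key] at hc
  have hleast : ∀ k, 0 < k → ∀ d, α ^ k = f d → e ≤ k := by
    intro k hk d hd
    exact hmin' ⟨hk, d, (key k d).2 hd⟩
  have hc0 : c ≠ 0 := by
    rintro rfl
    rw [map_zero] at hc
    exact hα0 (pow_eq_zero_iff hepos.ne' |>.1 hc)
  have hdvd : e ∣ ℓ + 1 := by
    rw [Nat.dvd_iff_mod_eq_zero]
    by_contra hne
    have hlt := Nat.mod_lt (ℓ + 1) hepos
    have h1 := Nat.div_add_mod (ℓ + 1) e
    rw [← h1, pow_add, pow_mul, hc, ← map_pow] at hnorm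
    have h3 : f (c ^ ((ℓ + 1) / e)) ≠ 0 := by
      rw [Ne, map_eq_zero]; exact pow_ne_zero _ hc0
    have := hleast _ (Nat.pos_of_ne_zero hne) (q / c ^ ((ℓ + 1) / e)) (by
      rw [map_div₀, eq_div_iff h3, mul_comm]; exact hnorm)
    omega
  refine ⟨hdvd, ?_⟩
  obtain ⟨r, hr⟩ := hdvd
  rw [hr, Nat.mul_div_cancel_left _ hepos]
  have hqc : q = c ^ r := by
    apply hinj
    rw [← hnorm, hr, pow_mul, hc, map_pow]
  constructor
  · intro h
    rw [hqc]; exact h.isSquare_pow c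
  · intro hs
    by_contra hr2
    rw [Nat.not_even_iff_odd] at hr2
    have hee : Even e := by
      have : Even (e * r) := by rw [← hr]; exact hodd.add_one
      rcases Nat.even_mul.1 this with h | h
      · exact h
      · exact absurd h (Nat.not_even_iff_odd.2 hr2)
    obtain ⟨m, hm⟩ := hr2
    obtain ⟨s, hs⟩ := hs
    obtain ⟨n, hn⟩ := hee
    have hcs : c = (s / c ^ m) ^ 2 := by
      have : c ^ m ≠ 0 := pow_ne_zero _ hc0
      rw [div_pow, eq_div_iff (pow_ne_zero _ this), sq s, ← hs, hqc, hm]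
      ring
    set d := s / c ^ m
    have : (α ^ n) ^ 2 = (f d) ^ 2 := by
      rw [← map_pow, ← hcs, ← hc, hn]; ring
    rcases sq_eq_sq_iff_eq_or_eq_neg.1 this with h | h
    · have := hleast n (by omega) d h
      omega
    · have := hleast n (by omega) (-d) (by rw [h, map_neg])
      omega
end

section
/- Let ℓ be an odd prime and let M be an invertible 2×2 matrix over 𝔽_ℓ with trace t and determinant q such that t² − 4q is a nonzero square in 𝔽_ℓ. Let e be the least positive integer such that M^e is a scalar matrix. Then e divides ℓ − 1, and for every one-dimensional 𝔽_ℓ-subspace U of 𝔽_ℓ² with M·U ≠ U, the least positive integer k with M^k·U = U equals e. -/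
open Matrix

theorem pow_lin {F : Type*} [Field F] (M : Matrix (Fin 2) (Fin 2) F) (a b : F)
    (hs : M.trace = a + b) (hp : M.det = a * b) (k : ℕ) :
    ∃ x y : F, M ^ k = x • M + y • (1 : Matrix (Fin 2) (Fin 2) F) ∧
      a ^ k = x * a + y ∧ b ^ k = x * b + y := by
  have hch : M * M = (a + b) • M - (a * b) • (1 : Matrix (Fin 2) (Fin 2) F) := by
    rw [← hs, ← hp, Matrix.det_fin_two, Matrix.trace_fin_two]
    ext i j
    fin_cases i <;> fin_cases j <;> simp [Matrix.mul_apply, Fin.sum_univ_two] <;> ring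
  induction k with
  | zero => exact ⟨0, 1, by simp, by simp, by simp⟩
  | succ k ih =>
    obtain ⟨x, y, h1, h2, h3⟩ := ih
    refine ⟨x * (a + b) + y, -(x * (a * b)), ?_, ?_, ?_⟩
    · rw [pow_succ, h1, add_mul, smul_mul_assoc, smul_mul_assoc, hch, one_mul]
      module
    · rw [pow_succ, h2]; ring
    · rw [pow_succ, h3]; ring

/-- If M is an invertible 2×2 matrix over 𝔽_ℓ with trace t and determinant q such that
t² − 4q is a nonzero square in 𝔽_ℓ, and e is the least positive integer with M^e
scalar, then e divides ℓ − 1, and for every one-dimensional subspace U of 𝔽_ℓ² with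
M·U ≠ U, the least positive integer k with M^k·U = U equals e. -/
theorem stmt12 (ℓ : ℕ) [Fact (Nat.Prime ℓ)] (hodd : Odd ℓ)
    (M : Matrix (Fin 2) (Fin 2) (ZMod ℓ)) (hM : IsUnit M)
    (t q : ZMod ℓ) (ht : M.trace = t) (hq : M.det = q)
    (hnz : t ^ 2 - 4 * q ≠ 0) (hsq : IsSquare (t ^ 2 - 4 * q))
    (e : ℕ)
    (he : IsLeast {k : ℕ | 0 < k ∧
      ∃ c : ZMod ℓ, M ^ k = c • (1 : Matrix (Fin 2) (Fin 2) (ZMod ℓ))} e) :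
    e ∣ ℓ - 1 ∧
      ∀ U : Submodule (ZMod ℓ) (Fin 2 → ZMod ℓ), Module.finrank (ZMod ℓ) U = 1 →
        U.map (Matrix.toLin' M) ≠ U →
        IsLeast {k : ℕ | 0 < k ∧ U.map (Matrix.toLin' (M ^ k)) = U} e := by
  have hl : ℓ ≠ 2 := by rintro rfl; exact absurd hodd (by decide)
  have h2 : (2 : ZMod ℓ) ≠ 0 := Ring.two_ne_zero (by rw [ZMod.ringChar_zmod_n]; exact hl)
  obtain ⟨s, hs⟩ := hsq
  have hq0 : q ≠ 0 := by
    rw [← hq]; exact ((Matrix.isUnit_iff_isUnit_det M).1 hM).ne_zero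
  obtain ⟨a, b, hab, habq, hne⟩ : ∃ a b : ZMod ℓ, t = a + b ∧ q = a * b ∧ a - b ≠ 0 := by
    refine ⟨(t + s) / 2, (t - s) / 2, by field_simp; ring, ?_, ?_⟩
    · field_simp
      linear_combination -hs
    · have : (t + s) / 2 - (t - s) / 2 = s := by field_simp; ring
      rw [this]; rintro rfl; exact hnz (by simpa using hs)
  have ha : a ≠ 0 := by rintro rfl; exact hq0 (by simpa using habq)
  have hb : b ≠ 0 := by rintro rfl; exact hq0 (by simpa using habq)
  have key := pow_lin M a b (ht.trans hab) (hq.trans habq)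
  obtain ⟨⟨he0, c, hc⟩, hmin⟩ := he
  have hc0 : c ≠ 0 := by
    rintro rfl
    have := hM.pow e
    rw [hc, zero_smul] at this
    exact not_isUnit_zero this
  refine ⟨?_, ?_⟩
  · obtain ⟨x, y, h, hxa, hxb⟩ := key (ℓ - 1)
    rw [ZMod.pow_card_sub_one_eq_one ha] at hxa
    rw [ZMod.pow_card_sub_one_eq_one hb] at hxb
    have hx : x = 0 := by
      have : x * (a - b) = 0 := by linear_combination hxb - hxa
      exact (mul_eq_zero.1 this).resolve_right hne
    rw [hx, zero_smul, zero_add] at h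
    rw [Nat.dvd_iff_mod_eq_zero]
    by_contra hr
    have hlt := Nat.mod_lt (ℓ - 1) he0
    refine absurd (hmin ⟨Nat.pos_of_ne_zero hr, (c ^ ((ℓ - 1) / e))⁻¹ * y, ?_⟩) (not_le.2 hlt)
    rw [← Nat.div_add_mod (ℓ - 1) e, pow_add, pow_mul, hc, smul_pow, one_pow,
      smul_mul_assoc, one_mul] at h
    rw [mul_smul, ← h, smul_smul, inv_mul_cancel₀ (pow_ne_zero _ hc0), one_smul]
  · intro U _ hMU
    refine ⟨⟨he0, ?_⟩, ?_⟩
    · rw [hc, map_smul, Submodule.map_smul _ _ _ hc0, Matrix.toLin'_one, Submodule.map_id]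
    · rintro k ⟨hk0, hk⟩
      by_contra hlt
      obtain ⟨x, y, h, -, -⟩ := key k
      have hx : x ≠ 0 := by
        rintro rfl
        exact hlt (hmin ⟨hk0, y, by simpa using h⟩)
      apply hMU
      have hle : U.map (Matrix.toLin' M) ≤ U := by
        rintro _ ⟨u, hu, rfl⟩
        have h1 : Matrix.toLin' (M ^ k) u ∈ U := by
          have := Submodule.mem_map_of_mem (f := Matrix.toLin' (M ^ k)) hu
          rwa [hk] at this
        have h3 : Matrix.toLin' M u = x⁻¹ • (Matrix.toLin' (M ^ k) u - y • u) := by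
          rw [h]
          simp [Matrix.add_mulVec, Matrix.smul_mulVec, smul_smul, hx]
        rw [h3]
        exact U.smul_mem _ (U.sub_mem h1 (U.smul_mem _ hu))
      apply Submodule.eq_of_le_of_finrank_eq hle
      exact (Submodule.equivMapOfInjective (Matrix.toLin' M)
        (Matrix.mulVec_injective_of_isUnit hM) U).finrank_eq.symm
end

section
/- Let ℓ be an odd prime and let M be an invertible 2×2 matrix over 𝔽_ℓ with trace t and determinant q such that t² = 4q and M is not a scalar matrix. Then for every one-dimensional 𝔽_ℓ-subspace U of 𝔽_ℓ² with M·U ≠ U, the least positive integer k with M^k·U = U equals ℓ. -/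
open Matrix

theorem aux_pow_s13 {R : Type*} [CommRing R] (M : Matrix (Fin 2) (Fin 2) R) (a : R)
    (h : M * M = (2 * a) • M - (a ^ 2) • (1 : Matrix (Fin 2) (Fin 2) R)) (k : ℕ) :
    M ^ (k + 1) = (((k : R) + 1) * a ^ k) • M - ((k : R) * a ^ (k + 1)) • (1 : Matrix (Fin 2) (Fin 2) R) := by
  induction k with
  | zero => simp
  | succ k ih =>
    rw [pow_succ, ih, sub_mul, smul_mul_assoc, h, smul_mul_assoc, one_mul]
    push_cast
    module

/-- If M is an invertible 2×2 matrix over 𝔽_ℓ with trace t and determinant q such that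
t² = 4q and M is not scalar, then for every one-dimensional subspace U of 𝔽_ℓ² with
M·U ≠ U, the least positive integer k with M^k·U = U equals ℓ. -/
theorem stmt13 (ℓ : ℕ) [Fact (Nat.Prime ℓ)] (hodd : Odd ℓ)
    (M : Matrix (Fin 2) (Fin 2) (ZMod ℓ)) (hM : IsUnit M)
    (t q : ZMod ℓ) (ht : M.trace = t) (hq : M.det = q)
    (hrep : t ^ 2 = 4 * q)
    (hns : ¬ ∃ c : ZMod ℓ, M = c • (1 : Matrix (Fin 2) (Fin 2) (ZMod ℓ))) :
    ∀ U : Submodule (ZMod ℓ) (Fin 2 → ZMod ℓ), Module.finrank (ZMod ℓ) U = 1 →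
      U.map (Matrix.toLin' M) ≠ U →
      IsLeast {k : ℕ | 0 < k ∧ U.map (Matrix.toLin' (M ^ k)) = U} ℓ := by
  intro U _ hU
  have hp : Nat.Prime ℓ := Fact.out
  have h2 : (2 : ZMod ℓ) ≠ 0 := by
    intro h
    have h' : ((2 : ℕ) : ZMod ℓ) = 0 := by exact_mod_cast h
    rw [ZMod.natCast_eq_zero_iff] at h'
    rcases (Nat.dvd_prime Nat.prime_two).1 h' with h1 | h1
    · exact hp.one_lt.ne' h1
    · rw [h1] at hodd
      exact absurd hodd (by decide)
  obtain ⟨a, ha⟩ : ∃ a : ZMod ℓ, t = 2 * a := ⟨t / 2, by field_simp⟩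
  have hqa : q = a ^ 2 := by
    subst ha
    have : (2 * 2) * (q - a ^ 2) = 0 := by linear_combination -hrep
    rcases mul_eq_zero.1 this with h | h
    · exact absurd h (mul_ne_zero h2 h2)
    · exact sub_eq_zero.1 h
  have hq0 : q ≠ 0 := by
    rw [← hq]
    exact ((Matrix.isUnit_iff_isUnit_det M).1 hM).ne_zero
  have ha0 : a ≠ 0 := by
    rintro rfl
    exact hq0 (by simp [hqa])
  have hMM : M * M = (2 * a) • M - (a ^ 2) • (1 : Matrix (Fin 2) (Fin 2) (ZMod ℓ)) := by
    rw [← ha, ← hqa, ← ht, ← hq]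
    ext i j
    fin_cases i <;> fin_cases j <;>
      simp [Matrix.mul_apply, Fin.sum_univ_two, Matrix.trace_fin_two, Matrix.det_fin_two] <;> ring
  have hpow := aux_pow_s13 M a hMM
  refine ⟨⟨hp.pos, ?_⟩, ?_⟩
  · obtain ⟨k, hk⟩ : ∃ k, ℓ = k + 1 := ⟨ℓ - 1, by have := hp.pos; omega⟩
    have hk0 : (k : ZMod ℓ) + 1 = 0 := by
      have : ((k + 1 : ℕ) : ZMod ℓ) = 0 := by rw [← hk]; simp
      exact_mod_cast this
    have hMl : M ^ ℓ = (a ^ (k + 1)) • (1 : Matrix (Fin 2) (Fin 2) (ZMod ℓ)) := by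
      have h1 : (k : ZMod ℓ) = -1 := by linear_combination hk0
      have h3 := hpow k
      rw [← hk] at h3
      rw [h3, hk0, h1, ← hk]
      module
    rw [hMl, map_smul, Matrix.toLin'_one, Submodule.map_smul _ _ _ (pow_ne_zero _ ha0)]
    exact Submodule.map_id U
  · rintro k ⟨hk, hkU⟩
    by_contra hlt
    push Not at hlt
    obtain ⟨m, rfl⟩ : ∃ m, k = m + 1 := ⟨k - 1, by omega⟩
    have hm0 : (m : ZMod ℓ) + 1 ≠ 0 := by
      intro h
      have h' : ((m + 1 : ℕ) : ZMod ℓ) = 0 := by exact_mod_cast h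
      rw [ZMod.natCast_eq_zero_iff] at h'
      exact absurd (Nat.le_of_dvd hk h') (by omega)
    have hle : U.map (Matrix.toLin' M) ≤ U := by
      rintro _ ⟨u, hu, rfl⟩
      have h1 : Matrix.toLin' (M ^ (m + 1)) u ∈ U := by
        rw [← hkU]
        exact ⟨u, hu, rfl⟩
      rw [hpow m, map_sub, map_smul, map_smul, Matrix.toLin'_one] at h1
      simp only [LinearMap.sub_apply, LinearMap.smul_apply, LinearMap.id_apply] at h1
      have h3 := U.add_mem h1 (U.smul_mem ((m : ZMod ℓ) * a ^ (m + 1)) hu)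
      rw [sub_add_cancel] at h3
      exact (U.smul_mem_iff (mul_ne_zero hm0 (pow_ne_zero _ ha0))).1 h3
    apply hU
    apply Submodule.eq_of_le_of_finrank_eq hle
    have hinj : Function.Injective (Matrix.toLin' M) := Matrix.mulVec_injective_of_isUnit hM
    exact (Submodule.equivMapOfInjective (Matrix.toLin' M) hinj U).finrank_eq.symm
end

section
/- Let ℓ be an odd prime and let M be an invertible 2×2 matrix over 𝔽_ℓ with trace t and determinant q. If the least positive integer e such that M^e is a scalar matrix equals 3, then t² = q in 𝔽_ℓ. -/
open Matrix

/-- If the least positive integer e with M^e scalar equals 3, then t² = q. -/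
theorem stmt16 (ℓ : ℕ) [Fact (Nat.Prime ℓ)] (hodd : Odd ℓ)
    (M : Matrix (Fin 2) (Fin 2) (ZMod ℓ)) (hM : IsUnit M)
    (t q : ZMod ℓ) (ht : M.trace = t) (hq : M.det = q)
    (he : IsLeast {k : ℕ | 0 < k ∧
      ∃ c : ZMod ℓ, M ^ k = c • (1 : Matrix (Fin 2) (Fin 2) (ZMod ℓ))} 3) :
    t ^ 2 = q := by
  obtain ⟨⟨-, c, hc⟩, hmin⟩ := he
  by_contra hne
  have hd : t ^ 2 - q ≠ 0 := sub_ne_zero.mpr hne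
  have key : (t ^ 2 - q) • M = (c + t * q) • (1 : Matrix (Fin 2) (Fin 2) (ZMod ℓ)) := by
    have h3 : M ^ 3 = (t ^ 2 - q) • M - (t * q) • (1 : Matrix (Fin 2) (Fin 2) (ZMod ℓ)) := by
      rw [← ht, ← hq]
      ext i j
      fin_cases i <;> fin_cases j <;>
        simp [pow_succ, Matrix.mul_apply, Fin.sum_univ_two, Matrix.trace_fin_two,
          Matrix.det_fin_two] <;> ring
    rw [add_smul, ← hc, h3]
    abel
  have h1 : (3 : ℕ) ≤ 1 := by
    apply hmin
    refine ⟨one_pos, (t ^ 2 - q)⁻¹ * (c + t * q), ?_⟩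
    rw [pow_one, mul_smul, ← key, smul_smul, inv_mul_cancel₀ hd, one_smul]
  omega
end

section
/- Let ℓ be an odd prime and let M be an invertible 2×2 matrix over 𝔽_ℓ with trace t and determinant q. If the least positive integer e such that M^e is a scalar matrix equals 4, then t² = 2q in 𝔽_ℓ. -/
open Matrix

/-- If the least positive integer e with M^e scalar equals 4, then t² = 2q. -/
theorem stmt17 (ℓ : ℕ) [Fact (Nat.Prime ℓ)] (hodd : Odd ℓ)
    (M : Matrix (Fin 2) (Fin 2) (ZMod ℓ)) (hM : IsUnit M)
    (t q : ZMod ℓ) (ht : M.trace = t) (hq : M.det = q)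
    (he : IsLeast {k : ℕ | 0 < k ∧
      ∃ c : ZMod ℓ, M ^ k = c • (1 : Matrix (Fin 2) (Fin 2) (ZMod ℓ))} 4) :
    t ^ 2 = 2 * q := by
  obtain ⟨⟨-, c, hc⟩, hmin⟩ := he
  have h2 : M ^ 2 = t • M - q • 1 := by
    subst ht hq
    ext i j
    fin_cases i <;> fin_cases j <;>
      simp [pow_two, Matrix.mul_apply, Fin.sum_univ_two, Matrix.trace_fin_two,
        Matrix.det_fin_two] <;> ring
  have h4 : M ^ 4 = (t * (t ^ 2 - 2 * q)) • M + (q ^ 2 - t ^ 2 * q) • 1 := by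
    have : M ^ 4 = M ^ 2 * M ^ 2 := by rw [← pow_add]
    rw [this, h2]
    simp only [sub_mul, mul_sub, smul_mul_assoc, mul_smul_comm, mul_one, one_mul]
    rw [← pow_two M, h2]
    module
  by_contra hne
  have hne' : t ^ 2 - 2 * q ≠ 0 := sub_ne_zero.mpr hne
  by_cases h0 : t = 0
  · have := hmin (a := 2) ⟨by norm_num, -q, by rw [h2, h0]; module⟩
    omega
  · have hk : t * (t ^ 2 - 2 * q) ≠ 0 := mul_ne_zero h0 hne'
    have h5 : (t * (t ^ 2 - 2 * q)) • M = (c - (q ^ 2 - t ^ 2 * q)) • (1 : Matrix (Fin 2) (Fin 2) (ZMod ℓ)) := by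
      rw [sub_smul, ← hc, h4]
      abel
    have := hmin (a := 1) ⟨by norm_num,
      (t * (t ^ 2 - 2 * q))⁻¹ * (c - (q ^ 2 - t ^ 2 * q)), by
        rw [mul_smul, ← h5, smul_smul, inv_mul_cancel₀ hk, one_smul, pow_one]⟩
    omega
end

section
/- Let ℓ be an odd prime and let M be an invertible 2×2 matrix over 𝔽_ℓ. Let e be the least positive integer such that M^e is a scalar matrix. Then e divides ℓ, or e divides ℓ − 1, or e divides ℓ + 1. -/
open Matrix

lemma aux_dvd (ℓ : ℕ) [Fact (Nat.Prime ℓ)] 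
    (M : Matrix (Fin 2) (Fin 2) (ZMod ℓ)) (hM : IsUnit M)
    (e : ℕ)
    (he : IsLeast {k : ℕ | 0 < k ∧
      ∃ c : ZMod ℓ, M ^ k = c • (1 : Matrix (Fin 2) (Fin 2) (ZMod ℓ))} e)
    (k : ℕ) (c' : ZMod ℓ) (hk : M ^ k = c' • (1 : Matrix (Fin 2) (Fin 2) (ZMod ℓ))) : e ∣ k := by
  obtain ⟨⟨hpos, c, hc⟩, hmin⟩ := he
  have hc0 : c ≠ 0 := by
    rintro rfl
    have h := hM.pow e
    rw [hc, zero_smul] at h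
    exact not_isUnit_zero h
  by_contra hnd
  have hr : 0 < k % e := Nat.pos_of_ne_zero fun h => hnd (Nat.dvd_of_mod_eq_zero h)
  have h1 : M ^ k = c ^ (k / e) • M ^ (k % e) := by
    conv_lhs => rw [← Nat.div_add_mod k e, pow_add, pow_mul, hc, smul_pow, one_pow, smul_mul_assoc, one_mul]
  have h2 : M ^ (k % e) = ((c ^ (k / e))⁻¹ * c') • (1 : Matrix (Fin 2) (Fin 2) (ZMod ℓ)) := by
    rw [mul_smul, ← hk, h1, smul_smul, inv_mul_cancel₀ (pow_ne_zero _ hc0), one_smul]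
  have := hmin ⟨hr, _, h2⟩
  have := Nat.mod_lt k hpos
  omega

/-- For an invertible 2×2 matrix M over 𝔽_ℓ (ℓ an odd prime), the least positive
integer e with M^e scalar divides ℓ, ℓ − 1, or ℓ + 1. -/
theorem stmt19 (ℓ : ℕ) [Fact (Nat.Prime ℓ)] (hodd : Odd ℓ)
    (M : Matrix (Fin 2) (Fin 2) (ZMod ℓ)) (hM : IsUnit M)
    (e : ℕ)
    (he : IsLeast {k : ℕ | 0 < k ∧
      ∃ c : ZMod ℓ, M ^ k = c • (1 : Matrix (Fin 2) (Fin 2) (ZMod ℓ))} e) :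
    e ∣ ℓ ∨ e ∣ ℓ - 1 ∨ e ∣ ℓ + 1 := by
  have key := aux_dvd ℓ M hM e he
  have hp : Nat.Prime ℓ := Fact.out
  have h2 : (2 : ZMod ℓ) ≠ 0 := by
    intro h
    have h' : ((2 : ℕ) : ZMod ℓ) = 0 := by exact_mod_cast h
    rw [ZMod.natCast_eq_zero_iff] at h'
    have := (Nat.prime_dvd_prime_iff_eq hp Nat.prime_two).1 h'
    subst this
    exact absurd hodd (by decide)
  obtain ⟨a, ha⟩ : ∃ a : ZMod ℓ, 2 * a = M 0 0 + M 1 1 := ⟨(M 0 0 + M 1 1) / 2, by field_simp⟩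
  obtain ⟨N, hN⟩ : ∃ N, N = M - a • (1 : Matrix (Fin 2) (Fin 2) (ZMod ℓ)) := ⟨_, rfl⟩
  have hMN : M = a • 1 + N := by rw [hN]; abel
  obtain ⟨d, hd⟩ : ∃ d : ZMod ℓ, N ^ 2 = d • (1 : Matrix (Fin 2) (Fin 2) (ZMod ℓ)) := by
    refine ⟨(M 0 0 - a) ^ 2 + M 0 1 * M 1 0, ?_⟩
    rw [hN, pow_two]
    ext i j
    fin_cases i <;> fin_cases j <;> simp [Matrix.mul_apply, Fin.sum_univ_two] <;> grind
  obtain ⟨m, hm⟩ := hodd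
  have hNl : N ^ ℓ = d ^ m • N := by
    rw [show N ^ ℓ = N ^ (2 * m + 1) from congrArg (N ^ ·) hm, pow_add, pow_mul, hd, smul_pow, one_pow, pow_one, smul_mul_assoc, one_mul]
  have hMl : M ^ ℓ = a • 1 + d ^ m • N := by
    have hcomm : Commute (a • (1 : Matrix (Fin 2) (Fin 2) (ZMod ℓ))) N :=
      (Commute.one_left N).smul_left a
    rw [hMN, add_pow_char_of_commute _ hcomm, hNl, smul_pow, one_pow, ZMod.pow_card]
  by_cases hd0 : d ^ m = 0
  · left
    exact key ℓ a (by rw [hMl, hd0, zero_smul, add_zero])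
  have hd1 : d ^ m * d ^ m = 1 := by
    have hdd : d ≠ 0 := by
      rintro rfl
      by_cases hm0 : m = 0
      · subst hm0; exact hp.one_lt.ne' (by simpa using hm)
      · exact hd0 (zero_pow hm0)
    rw [← pow_add, ← ZMod.pow_card_sub_one_eq_one hdd]
    congr 1; omega
  right
  rcases mul_self_eq_one_iff.1 hd1 with h | h
  · left
    refine key _ 1 ?_
    rw [h, one_smul, ← hMN] at hMl
    apply hM.mul_left_cancel
    rw [← pow_succ', Nat.sub_add_cancel hp.one_lt.le, hMl, one_smul, mul_one]
  · right
    refine key _ (a ^ 2 - d) ?_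
    rw [pow_succ, hMl, h, sub_smul, ← hd, hMN]
    simp only [neg_smul, one_smul, add_mul, mul_add, smul_mul_assoc, mul_smul_comm, one_mul, mul_one, smul_add, smul_neg, smul_smul, neg_mul, pow_two]
    abel
end
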